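/- If τ ≤ D2(0) − D1(f1max), then the flow (d_HL, d_HH/n, d_AL) is a lane choice equilibrium, and every lane choice equilibrium equals (d_HL, d_HH/n, d_AL); i.e., the lane choice equilibrium exists and is unique. -/

import Mathlib

noncomputable section

/-- A feasible flow `f = (x, y, z)`: flows of (HV,LO), (HV,HO), (AV,LO) vehicles on lane 1. -/
def Feasible (dHL dHH dAL n : ℝ) (f : ℝ × ℝ × ℝ) : Prop :=
  0 ≤ f.1 ∧ f.1 ≤ dHL ∧ 0 ≤ f.2.1 ∧ f.2.1 ≤ dHH / n ∧ 0 ≤ f.2.2 ∧ f.2.2 ≤ dAL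

/-- Effective flow on lane 1. -/
def F1 (dAH n μ : ℝ) (f : ℝ × ℝ × ℝ) : ℝ :=
  f.1 + f.2.1 + μ * (f.2.2 + dAH / n)

/-- Theoretical minimum of the effective lane-1 flow. -/
def f1min (dAH n μ : ℝ) : ℝ := μ * dAH / n

/-- Theoretical maximum of the effective lane-1 flow. -/
def f1max (dHL dHH dAL dAH n μ : ℝ) : ℝ :=
  dHL + dHH / n + μ * (dAL + dAH / n)

/-- Lane choice (Wardrop) equilibrium under a uniform toll `τ`. -/
def IsEquilibrium (D1 D2 : ℝ → ℝ) (dHL dHH dAL dAH n μ τ : ℝ) (f : ℝ × ℝ × ℝ) : Prop :=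
  Feasible dHL dHH dAL n f ∧
  (0 < f.1 → D1 (F1 dAH n μ f) + τ ≤ D2 (f1max dHL dHH dAL dAH n μ - F1 dAH n μ f)) ∧
  (f.1 < dHL → D2 (f1max dHL dHH dAL dAH n μ - F1 dAH n μ f) ≤ D1 (F1 dAH n μ f) + τ) ∧
  (0 < f.2.1 → D1 (F1 dAH n μ f) + τ ≤ D2 (f1max dHL dHH dAL dAH n μ - F1 dAH n μ f)) ∧
  (f.2.1 < dHH / n → D2 (f1max dHL dHH dAL dAH n μ - F1 dAH n μ f) ≤ D1 (F1 dAH n μ f) + τ) ∧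
  (0 < f.2.2 → D1 (F1 dAH n μ f) + τ ≤ D2 (f1max dHL dHH dAL dAH n μ - F1 dAH n μ f)) ∧
  (f.2.2 < dAL → D2 (f1max dHL dHH dAL dAH n μ - F1 dAH n μ f) ≤ D1 (F1 dAH n μ f) + τ)

theorem equilibrium_unique_low_toll
    (D1 D2 : ℝ → ℝ) (dHL dHH dAL dAH n μ : ℝ)
    (hdHL : 0 ≤ dHL) (hdHH : 0 ≤ dHH) (hdAL : 0 ≤ dAL) (hdAH : 0 ≤ dAH)
    (hn : 2 ≤ n) (hμ0 : 0 < μ) (hμ1 : μ < 1)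
    (hD1c : Continuous D1) (hD1m : StrictMono D1)
    (hD2c : Continuous D2) (hD2m : StrictMono D2)
    (τ : ℝ) (hτ : 0 ≤ τ)
    (hτsmall : τ ≤ D2 0 - D1 (f1max dHL dHH dAL dAH n μ)) :
    IsEquilibrium D1 D2 dHL dHH dAL dAH n μ τ (dHL, dHH / n, dAL) ∧
      ∀ f : ℝ × ℝ × ℝ, IsEquilibrium D1 D2 dHL dHH dAL dAH n μ τ f → f = (dHL, dHH / n, dAL) := by
  have hy0 : 0 ≤ dHH / n := div_nonneg hdHH (by linarith)
  constructor
  · have hF : F1 dAH n μ (dHL, dHH / n, dAL) = f1max dHL dHH dAL dAH n μ := rfl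
    unfold IsEquilibrium
    rw [hF, sub_self]
    refine ⟨⟨hdHL, le_refl _, hy0, le_refl _, hdAL, le_refl _⟩, ?_, ?_, ?_, ?_, ?_, ?_⟩
    · intro _; linarith
    · intro h; exact absurd h (lt_irrefl _)
    · intro _; linarith
    · intro h; exact absurd h (lt_irrefl _)
    · intro _; linarith
    · intro h; exact absurd h (lt_irrefl _)
  · rintro ⟨x, y, z⟩ ⟨⟨_, hx, _, hy, _, hz⟩, _, h1, _, h2, _, h3⟩
    dsimp only at hx hy hz h1 h2 h3
    have hμz : μ * z ≤ μ * dAL := mul_le_mul_of_nonneg_left hz hμ0.le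
    -- if the effective flow is below its maximum, lane 1 is strictly cheaper
    have key : F1 dAH n μ (x, y, z) < f1max dHL dHH dAL dAH n μ →
        D1 (F1 dAH n μ (x, y, z)) + τ <
          D2 (f1max dHL dHH dAL dAH n μ - F1 dAH n μ (x, y, z)) := by
      intro h
      have a := hD1m h
      have b := hD2m (sub_pos.mpr h)
      linarith
    have ex : x = dHL := by
      by_contra hne
      have hlt := lt_of_le_of_ne hx hne
      exact absurd (h1 hlt) (not_le.mpr (key (by simp only [F1, f1max]; linarith)))
    have ey : y = dHH / n := by
      by_contra hne
      have hlt := lt_of_le_of_ne hy hne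
      exact absurd (h2 hlt) (not_le.mpr (key (by simp only [F1, f1max]; linarith)))
    have ez : z = dAL := by
      by_contra hne
      have hlt := lt_of_le_of_ne hz hne
      have hm := mul_lt_mul_of_pos_left hlt hμ0
      exact absurd (h3 hlt) (not_le.mpr (key (by simp only [F1, f1max]; linarith)))
    rw [ex, ey, ez]
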